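/- arXiv:2603.26366 — 4 statements merged into one kernel-verified Lean document; each statement's English description precedes it below -/
import Mathlib

section
/- Invariance of the group of a cut-diagram under the third topological move (R3): Let C be an n-component string-link cut-diagram. Suppose that component i carries two consecutive cut-points, at positions t and t+1 (1 ≤ t, t+1 ≤ m_i), with values (ε_{i,t},ℓ_{i,t}) = (η, B) and (ε_{i,t+1},ℓ_{i,t+1}) = (ε, A), such that: (1) the region (i,t) lying between these two cut-points does not occur as the label of any cut-point of C; and (2) there is a cut-point of C at some position u of some component j, distinct from the two cut-points above, with sign ε_{j,u} = ε, label ℓ_{j,u} = A, and whose preceding region (j,u−1) equals B; write D := (j,u) for its following region. Let C′ be the string-link cut-diagram obtained from C by replacing the two cut-points at positions t and t+1 of component i by (ε, A) followed by (η, D), all other cut-points, signs and labels being unchanged. Then there is a group isomorphism G(C) → G(C′) sending x_r to x_r for every region r ≠ (i,t). -/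
/-!
STATEMENT 8. String-link cut-diagram framework; see the definitions below.
Cut-points of component `i` are `0`-indexed by `t < m i` (the `t`-th
cut-point is the paper's `(t+1)`-st, lying between regions `(i,t)` and
`(i,t+1)`). The paper's two consecutive positions `t, t+1` (1-indexed) are
`a, a+1` (0-indexed), and the paper's auxiliary cut-point at position `u`
with preceding region `(j,u-1)` is `0`-indexed as `u` with preceding region
`(j,u)` and following region `D = (j,u+1)`.
-/

namespace CutDiagrams

/-- Regions of an `n`-component string-link cut-diagram: `(j, k)` with
`0 ≤ k ≤ m j`. -/
def Reg {n : ℕ} (m : Fin n → ℕ) : Type := {r : Fin n × ℕ // r.2 ≤ m r.1}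

/-- An `n`-component string-link cut-diagram. -/
structure SLCD (n : ℕ) where
  m : Fin n → ℕ
  sign : (i : Fin n) → (t : ℕ) → t < m i → ℤˣ
  label : (i : Fin n) → (t : ℕ) → t < m i → Reg m

variable {n : ℕ}

/-- The region just before the `t`-th cut-point of component `i`. -/
def prevReg (C : SLCD n) (i : Fin n) (t : ℕ) (h : t < C.m i) : Reg C.m := ⟨(i, t), h.le⟩

/-- The region just after the `t`-th cut-point of component `i`. -/
def nextReg (C : SLCD n) (i : Fin n) (t : ℕ) (h : t < C.m i) : Reg C.m := ⟨(i, t + 1), h⟩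

/-- The relator `x_{(i,t+1)}⁻¹ · x_ℓ^{-ε} · x_{(i,t)} · x_ℓ^{ε}` associated to a
cut-point, expressing the Wirtinger-type relation
`x_{(i,t+1)} = x_ℓ^{-ε} x_{(i,t)} x_ℓ^{ε}`. -/
def relWord (C : SLCD n) (i : Fin n) (t : ℕ) (h : t < C.m i) : FreeGroup (Reg C.m) :=
  (FreeGroup.of (nextReg C i t h))⁻¹ *
    (FreeGroup.of (C.label i t h)) ^ (-((C.sign i t h : ℤˣ) : ℤ)) *
    FreeGroup.of (prevReg C i t h) *
    (FreeGroup.of (C.label i t h)) ^ (((C.sign i t h : ℤˣ) : ℤ))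

/-- The set of relators of a string-link cut-diagram. -/
def rels (C : SLCD n) : Set (FreeGroup (Reg C.m)) :=
  {w | ∃ (i : Fin n) (t : ℕ) (h : t < C.m i), w = relWord C i t h}

/-- The group `G(C)` of a string-link cut-diagram. -/
abbrev G (C : SLCD n) : Type := PresentedGroup (rels C)

/-- The homomorphism `φ : F → G(C)` determined by `φ(x_i) = x_{(i,0)}`. -/
def phi (C : SLCD n) : FreeGroup (Fin n) →* G C :=
  FreeGroup.lift fun i => PresentedGroup.of ⟨(i, 0), Nat.zero_le _⟩


/-- The string-link cut-diagram `C'` obtained from `C` by an R3 move: the two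
consecutive cut-points of component `i` at (`0`-indexed) positions `a` and
`a+1`, with values `(η, B)` and `(ε, A)`, are replaced by `(ε, A)` followed by
`(η, D)`, where `(j,u)` is the auxiliary cut-point (with sign `ε`, label `A`
and preceding region `B`) and `D = (j, u+1)` is its following region; all
other cut-points, signs and labels are unchanged. Here
`ε = C.sign i (a+1)`, `η = C.sign i a`, `A = C.label i (a+1)`. -/
def slR3 (C : SLCD n) (i : Fin n) (a : ℕ) (ha : a + 1 < C.m i)
    (j : Fin n) (u : ℕ) (hu : u < C.m j) : SLCD n where
  m := C.m
  sign := fun j' t ht =>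
    if j' = i ∧ t = a then C.sign i (a + 1) ha
    else if j' = i ∧ t = a + 1 then C.sign i a (Nat.lt_of_succ_lt ha)
    else C.sign j' t ht
  label := fun j' t ht =>
    if j' = i ∧ t = a then C.label i (a + 1) ha
    else if j' = i ∧ t = a + 1 then ⟨(j, u + 1), hu⟩
    else C.label j' t ht

end CutDiagrams

namespace CutDiagrams

/-- A map from the regions of `C` to a group satisfying the Wirtinger relations of `C`. -/
def IsColoring {n : ℕ} (C : SLCD n) {H : Type*} [Group H] (f : Reg C.m → H) : Prop :=
  ∀ (i : Fin n) (t : ℕ) (h : t < C.m i),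
    f (nextReg C i t h) = f (C.label i t h) ^ (-((C.sign i t h : ℤˣ) : ℤ)) *
      f (prevReg C i t h) * f (C.label i t h) ^ ((C.sign i t h : ℤˣ) : ℤ)

theorem lift_relWord {n : ℕ} (C : SLCD n) {H : Type*} [Group H] (f : Reg C.m → H)
    (i : Fin n) (t : ℕ) (h : t < C.m i) :
    FreeGroup.lift f (relWord C i t h) = 1 ↔
      f (nextReg C i t h) = f (C.label i t h) ^ (-((C.sign i t h : ℤˣ) : ℤ)) *
        f (prevReg C i t h) * f (C.label i t h) ^ ((C.sign i t h : ℤˣ) : ℤ) := by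
  simp only [relWord, map_mul, map_inv, map_zpow, FreeGroup.lift_apply_of, mul_assoc,
    inv_mul_eq_one]

theorem isColoring_of {n : ℕ} (C : SLCD n) :
    IsColoring C (fun r => (PresentedGroup.of r : G C)) := by
  intro i t h
  rw [← lift_relWord C (fun r => (PresentedGroup.of r : G C))]
  have hmk : FreeGroup.lift (fun r => (PresentedGroup.of r : G C)) =
      PresentedGroup.mk (rels C) := by
    ext r
    simp [PresentedGroup.of]
  rw [hmk]
  exact PresentedGroup.one_of_mem ⟨i, t, h, rfl⟩

/-- The homomorphism from `G C` induced by a coloring. -/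
def IsColoring.hom {n : ℕ} {C : SLCD n} {H : Type*} [Group H] {f : Reg C.m → H}
    (hf : IsColoring C f) : G C →* H :=
  PresentedGroup.toGroup (f := f) (by
    rintro _ ⟨i, t, h, rfl⟩
    exact (lift_relWord C f i t h).2 (hf i t h))

@[simp]
theorem IsColoring.hom_of {n : ℕ} {C : SLCD n} {H : Type*} [Group H] {f : Reg C.m → H}
    (hf : IsColoring C f) (r : Reg C.m) : hf.hom (PresentedGroup.of r) = f r :=
  PresentedGroup.toGroup.of _

theorem conj_zpow_conj {H : Type*} [Group H] (A B x : H) (ε η : ℤ) :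
    (A ^ (-ε) * B * A ^ ε) ^ (-η) * (A ^ (-ε) * x * A ^ ε) * (A ^ (-ε) * B * A ^ ε) ^ η =
      A ^ (-ε) * (B ^ (-η) * x * B ^ η) * A ^ ε := by
  have key (k : ℤ) : (A ^ (-ε) * B * A ^ ε) ^ k = A ^ (-ε) * B ^ k * A ^ ε := by
    have := conj_zpow (i := k) (a := A ^ (-ε)) (b := B)
    simpa only [zpow_neg, inv_inv] using this
  rw [key, key]
  group

section R3

variable {n : ℕ} {C : SLCD n} {i : Fin n} {a : ℕ} {ha : a + 1 < C.m i}
  {j : Fin n} {u : ℕ} {hu : u < C.m j} {H : Type*} [Group H]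

theorem isColoring_slR3_iff {f : Reg C.m → H} :
    IsColoring (slR3 C i a ha j u hu) f ↔
      (f (nextReg C i a (Nat.lt_of_succ_lt ha)) =
        f (C.label i (a + 1) ha) ^ (-((C.sign i (a + 1) ha : ℤˣ) : ℤ)) *
          f (prevReg C i a (Nat.lt_of_succ_lt ha)) *
          f (C.label i (a + 1) ha) ^ ((C.sign i (a + 1) ha : ℤˣ) : ℤ)) ∧
      (f (nextReg C i (a + 1) ha) =
        f (nextReg C j u hu) ^ (-((C.sign i a (Nat.lt_of_succ_lt ha) : ℤˣ) : ℤ)) *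
          f (nextReg C i a (Nat.lt_of_succ_lt ha)) *
          f (nextReg C j u hu) ^ ((C.sign i a (Nat.lt_of_succ_lt ha) : ℤˣ) : ℤ)) ∧
      ∀ (k : Fin n) (t : ℕ) (ht : t < C.m k), ¬(k = i ∧ t = a) → ¬(k = i ∧ t = a + 1) →
        f (nextReg C k t ht) = f (C.label k t ht) ^ (-((C.sign k t ht : ℤˣ) : ℤ)) *
          f (prevReg C k t ht) * f (C.label k t ht) ^ ((C.sign k t ht : ℤˣ) : ℤ) := by
  have congr_rel {l l' : Reg C.m} {s s' : ℤˣ} (hl : l = l') (hs : s = s') (x y : H) :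
      x = f l ^ (-(s : ℤ)) * y * f l ^ (s : ℤ) ↔ x = f l' ^ (-(s' : ℤ)) * y * f l' ^ (s' : ℤ) := by
    rw [hl, hs]
  have h₀ : ¬(i = i ∧ a + 1 = a) := by simp
  constructor
  · intro hf
    refine ⟨?_, ?_, fun k t ht h₁ h₂ => ?_⟩
    · exact (congr_rel (if_pos ⟨rfl, rfl⟩) (if_pos ⟨rfl, rfl⟩) _ _).1
        (hf i a (Nat.lt_of_succ_lt ha))
    · exact (congr_rel ((if_neg h₀).trans (if_pos ⟨rfl, rfl⟩))
        ((if_neg h₀).trans (if_pos ⟨rfl, rfl⟩)) _ _).1 (hf i (a + 1) ha)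
    · exact (congr_rel ((if_neg h₁).trans (if_neg h₂)) ((if_neg h₁).trans (if_neg h₂)) _ _).1
        (hf k t ht)
  · rintro ⟨hA, hD, hf⟩ k t ht
    by_cases h₁ : k = i ∧ t = a
    · obtain ⟨rfl, rfl⟩ := h₁
      exact (congr_rel (if_pos ⟨rfl, rfl⟩) (if_pos ⟨rfl, rfl⟩) _ _).2 hA
    by_cases h₂ : k = i ∧ t = a + 1
    · obtain ⟨rfl, rfl⟩ := h₂
      exact (congr_rel ((if_neg h₀).trans (if_pos ⟨rfl, rfl⟩))
        ((if_neg h₀).trans (if_pos ⟨rfl, rfl⟩)) _ _).2 hD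
    · exact (congr_rel ((if_neg h₁).trans (if_neg h₂)) ((if_neg h₁).trans (if_neg h₂)) _ _).2
        (hf k t ht h₁ h₂)

theorem reg_ne {m : Fin n → ℕ} {k l : Fin n} {s t : ℕ} {hs : s ≤ m k} {ht : t ≤ m l}
    (h : ¬(k = l ∧ s = t)) : (⟨(k, s), hs⟩ : Reg m) ≠ ⟨(l, t), ht⟩ := fun e =>
  h (by simpa using congrArg Subtype.val e)

/-- A coloring of `C` becomes a coloring of the diagram after an R3 move once the color of the
middle region is corrected. -/
theorem IsColoring.to_slR3
    (hmid : ∀ (j' : Fin n) (t : ℕ) (ht : t < C.m j'),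
      C.label j' t ht ≠ ⟨(i, a + 1), ha.le⟩)
    (hne : ¬(j = i ∧ u = a) ∧ ¬(j = i ∧ u = a + 1))
    (hsign : C.sign j u hu = C.sign i (a + 1) ha)
    (hlabel : C.label j u hu = C.label i (a + 1) ha)
    (hprev : (⟨(j, u), hu.le⟩ : Reg C.m) = C.label i a (Nat.lt_of_succ_lt ha))
    {f g : Reg C.m → H} (hf : IsColoring C f)
    (hfg : ∀ r : Reg C.m, r ≠ ⟨(i, a + 1), ha.le⟩ → g r = f r)
    (hg : g ⟨(i, a + 1), ha.le⟩ =
      f (C.label i (a + 1) ha) ^ (-((C.sign i (a + 1) ha : ℤˣ) : ℤ)) *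
        f (prevReg C i a (Nat.lt_of_succ_lt ha)) *
        f (C.label i (a + 1) ha) ^ ((C.sign i (a + 1) ha : ℤˣ) : ℤ)) :
    IsColoring (slR3 C i a ha j u hu) g := by
  have hD := hf j u hu
  have hB : prevReg C j u hu = C.label i a (Nat.lt_of_succ_lt ha) := hprev
  rw [hsign, hlabel, hB] at hD
  have hE := hf i (a + 1) ha
  have hN : prevReg C i (a + 1) ha = nextReg C i a (Nat.lt_of_succ_lt ha) := rfl
  rw [hN, hf i a (Nat.lt_of_succ_lt ha)] at hE
  have hg' : g (nextReg C i a (Nat.lt_of_succ_lt ha)) = _ := hg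
  refine isColoring_slR3_iff.2 ⟨?_, ?_, fun k t ht h₁ h₂ => ?_⟩
  · rw [hg', hfg _ (hmid _ _ _), hfg (prevReg C i a _) (reg_ne (by simp))]
  · rw [hg', hfg (nextReg C i (a + 1) _) (reg_ne (by simp)),
      hfg (nextReg C j u hu) (reg_ne (by simpa using hne.1)), hE, hD, conj_zpow_conj]
  · rw [hfg _ (hmid _ _ _), hfg (nextReg C k t ht) (reg_ne (by simpa using h₁)),
      hfg (prevReg C k t ht) (reg_ne h₂)]
    exact hf k t ht

/-- A coloring of the diagram after an R3 move becomes a coloring of `C` once the color of the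
middle region is corrected. -/
theorem IsColoring.of_slR3
    (hmid : ∀ (j' : Fin n) (t : ℕ) (ht : t < C.m j'),
      C.label j' t ht ≠ ⟨(i, a + 1), ha.le⟩)
    (hne : ¬(j = i ∧ u = a) ∧ ¬(j = i ∧ u = a + 1))
    (hsign : C.sign j u hu = C.sign i (a + 1) ha)
    (hlabel : C.label j u hu = C.label i (a + 1) ha)
    (hprev : (⟨(j, u), hu.le⟩ : Reg C.m) = C.label i a (Nat.lt_of_succ_lt ha))
    {f g : Reg C.m → H} (hf : IsColoring (slR3 C i a ha j u hu) f)
    (hfg : ∀ r : Reg C.m, r ≠ ⟨(i, a + 1), ha.le⟩ → g r = f r)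
    (hg : g ⟨(i, a + 1), ha.le⟩ =
      f (C.label i a (Nat.lt_of_succ_lt ha)) ^
          (-((C.sign i a (Nat.lt_of_succ_lt ha) : ℤˣ) : ℤ)) *
        f (prevReg C i a (Nat.lt_of_succ_lt ha)) *
        f (C.label i a (Nat.lt_of_succ_lt ha)) ^
          ((C.sign i a (Nat.lt_of_succ_lt ha) : ℤˣ) : ℤ)) :
    IsColoring C g := by
  obtain ⟨hA, hE, hf'⟩ := isColoring_slR3_iff.1 hf
  have hD := hf' j u hu hne.1 hne.2
  have hB : prevReg C j u hu = C.label i a (Nat.lt_of_succ_lt ha) := hprev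
  rw [hsign, hlabel, hB] at hD
  rw [hA, hD, conj_zpow_conj] at hE
  intro k t ht
  by_cases h₁ : k = i ∧ t = a
  · obtain ⟨rfl, rfl⟩ := h₁
    rw [hfg _ (hmid _ _ _), hfg (prevReg C k t ht) (reg_ne (by simp))]
    exact hg
  by_cases h₂ : k = i ∧ t = a + 1
  · obtain ⟨rfl, rfl⟩ := h₂
    have hN : g (prevReg C k (a + 1) ht) = _ := hg
    rw [hfg (nextReg C k (a + 1) ht) (reg_ne (by simp)), hfg _ (hmid _ _ _), hE, hN]
  · rw [hfg _ (hmid _ _ _), hfg (nextReg C k t ht) (reg_ne (by simpa using h₁)),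
      hfg (prevReg C k t ht) (reg_ne h₂)]
    exact hf' k t ht h₁ h₂

end R3

end CutDiagrams

open CutDiagrams in
/-- invariance of the group of a cut-diagram under the third
topological move (R3). Under hypotheses (1) (the middle region `(i,a+1)`
between the two consecutive cut-points occurs as no label) and (2) (there is a
distinct cut-point `(j,u)` with sign `ε`, label `A`, and preceding region `B`),
there is a group isomorphism `G(C) → G(C')` sending `x_r` to `x_r` for every
region `r ≠ (i,a+1)`. (Paper positions `t, t+1` are `0`-indexed as `a, a+1`,
and the paper's middle region `(i,t)` is `(i, a+1)`.) -/
theorem stmt8 (n : ℕ) (C : SLCD n) (i : Fin n) (a : ℕ) (ha : a + 1 < C.m i)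
    (hmid : ∀ (j' : Fin n) (t : ℕ) (ht : t < C.m j'),
      C.label j' t ht ≠ ⟨(i, a + 1), ha.le⟩)
    (j : Fin n) (u : ℕ) (hu : u < C.m j)
    (hne : ¬(j = i ∧ u = a) ∧ ¬(j = i ∧ u = a + 1))
    (hsign : C.sign j u hu = C.sign i (a + 1) ha)
    (hlabel : C.label j u hu = C.label i (a + 1) ha)
    (hprev : (⟨(j, u), hu.le⟩ : Reg C.m) = C.label i a (Nat.lt_of_succ_lt ha)) :
    ∃ e : G C ≃* G (slR3 C i a ha j u hu),
      ∀ r : Reg C.m, r ≠ ⟨(i, a + 1), ha.le⟩ →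
        e (PresentedGroup.of r) = PresentedGroup.of r := by
  classical
  let M : Reg C.m := ⟨(i, a + 1), ha.le⟩
  have ha' := Nat.lt_of_succ_lt ha
  have hP : prevReg C i a ha' ≠ M := by
    intro e
    simpa [prevReg, M] using congrArg (fun r : Reg C.m => r.1.2) e
  let C' := slR3 C i a ha j u hu
  let x : Reg C.m → G C := fun r => PresentedGroup.of r
  let y : Reg C.m → G C' := fun r => PresentedGroup.of (rels := rels C') r
  have hx : IsColoring C x := isColoring_of C
  have hy : IsColoring C' y := isColoring_of C'
  have hf : IsColoring C (Function.update y M _) :=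
    hy.of_slR3 hmid hne hsign hlabel hprev (fun r hr => Function.update_of_ne hr _ _)
      (Function.update_self _ _ _)
  have hg : IsColoring C' (Function.update x M _) :=
    hx.to_slR3 hmid hne hsign hlabel hprev (fun r hr => Function.update_of_ne hr _ _)
      (Function.update_self _ _ _)
  have hfy (r : Reg C.m) (hr : r ≠ M) : hf.hom (x r) = y r :=
    (hf.hom_of r).trans (Function.update_of_ne hr _ _)
  have hgx (r : Reg C.m) (hr : r ≠ M) : hg.hom (y r) = x r :=
    (hg.hom_of r).trans (Function.update_of_ne hr _ _)
  refine ⟨MonoidHom.toMulEquiv hf.hom hg.hom ?_ ?_, hfy⟩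
  · refine PresentedGroup.ext fun r => ?_
    change hg.hom (hf.hom (x r)) = x r
    by_cases hr : r = M
    · subst hr
      have h : hf.hom (x M) = _ := (hf.hom_of M).trans (Function.update_self _ _ _)
      rw [h, map_mul, map_mul, map_zpow, map_zpow, hgx _ (hmid _ _ _), hgx _ hP]
      exact (hx i a ha').symm
    · rw [hfy r hr, hgx r hr]
  · refine PresentedGroup.ext fun r => ?_
    change hf.hom (hg.hom (y r)) = y r
    by_cases hr : r = M
    · subst hr
      have h : hg.hom (y M) = _ := (hg.hom_of M).trans (Function.update_self _ _ _)
      rw [h, map_mul, map_mul, map_zpow, map_zpow, hfy _ (hmid _ _ _), hfy _ hP]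
      exact (isColoring_slR3_iff.1 hy).1.symm
    · rw [hgx r hr, hfy r hr]
end

section
/- Meridian–longitude commutation: Let C be an n-component link cut-diagram. For each i∈{1,…,n}, the meridian μ_i := x_{(i,0)} commutes in G(C) with the image v̂_{i,m_i} := x_{ℓ_{i,1}}^{ε_{i,1}}⋯x_{ℓ_{i,m_i}}^{ε_{i,m_i}} ∈ G(C) of the full word of the i-th component; consequently μ_i also commutes with the i-th longitude λ̂_i := μ_i^{−s_i}·v̂_{i,m_i} ∈ G(C), where s_i is the sum of the signs ε_{i,t} over those t for which the label ℓ_{i,t} is a region of component i. -/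
/-!
STATEMENT 10. Link cut-diagram framework; see the definitions below.
Cut-points of component `i` are `0`-indexed by `t < m i`.
-/

namespace CutDiagrams

/-- Regions of an `n`-component link cut-diagram: `(j, k)` with
`0 ≤ k ≤ max (m j) 1 - 1` (a component with no cut-point is a single region). -/
def RegL {n : ℕ} (m : Fin n → ℕ) : Type := {r : Fin n × ℕ // r.2 < max (m r.1) 1}

/-- An `n`-component link cut-diagram (with a chosen basepoint on each circle):
component `i` carries `m i` cut-points, listed in the order met from the
basepoint following the orientation, each with a sign in `ℤˣ = {±1}` and a
label in the set of regions. -/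
structure LCD (n : ℕ) where
  m : Fin n → ℕ
  sign : (i : Fin n) → (t : ℕ) → t < m i → ℤˣ
  label : (i : Fin n) → (t : ℕ) → t < m i → RegL m

variable {n : ℕ}

/-- The region just before the `t`-th cut-point of component `i`
(`0`-indexed: the `t`-th cut-point is the paper's `(t+1)`-st). -/
def prevRegL (C : LCD n) (i : Fin n) (t : ℕ) (h : t < C.m i) : RegL C.m :=
  ⟨(i, t), lt_of_lt_of_le h (le_max_left _ _)⟩

/-- The region just after the `t`-th cut-point of component `i`, with cyclic
index `(t+1) % m i` (the paper's `(i, (t+1) mod m_i)` for the `(t+1)`-st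
cut-point). -/
def nextRegL (C : LCD n) (i : Fin n) (t : ℕ) (h : t < C.m i) : RegL C.m :=
  ⟨(i, (t + 1) % C.m i),
    lt_of_lt_of_le (Nat.mod_lt _ (lt_of_le_of_lt (Nat.zero_le t) h)) (le_max_left _ _)⟩

/-- The relator `x_{(i,(t+1) mod m_i)}⁻¹ · x_ℓ^{-ε} · x_{(i,t)} · x_ℓ^{ε}`
associated with a cut-point. -/
def relWordL (C : LCD n) (i : Fin n) (t : ℕ) (h : t < C.m i) : FreeGroup (RegL C.m) :=
  (FreeGroup.of (nextRegL C i t h))⁻¹ *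
    (FreeGroup.of (C.label i t h)) ^ (-((C.sign i t h : ℤˣ) : ℤ)) *
    FreeGroup.of (prevRegL C i t h) *
    (FreeGroup.of (C.label i t h)) ^ (((C.sign i t h : ℤˣ) : ℤ))

/-- The set of relators of a link cut-diagram. -/
def relsL (C : LCD n) : Set (FreeGroup (RegL C.m)) :=
  {w | ∃ (i : Fin n) (t : ℕ) (h : t < C.m i), w = relWordL C i t h}

/-- The group `G(C)` of a link cut-diagram. -/
abbrev GrL (C : LCD n) : Type := PresentedGroup (relsL C)

/-- The region `(i,0)` containing the basepoint of component `i`. -/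
def baseRegL (C : LCD n) (i : Fin n) : RegL C.m :=
  ⟨(i, 0), lt_of_lt_of_le Nat.zero_lt_one (le_max_right _ _)⟩

/-- The homomorphism `φ : F → G(C)` determined by `φ(x_i) = x_{(i,0)}`. -/
def phiL (C : LCD n) : FreeGroup (Fin n) →* GrL C :=
  FreeGroup.lift fun i => PresentedGroup.of (baseRegL C i)

/-- The word `v_{i,k} = x_{ℓ_{i,1}}^{ε_{i,1}} ⋯ x_{ℓ_{i,k}}^{ε_{i,k}}` in the free
group on the regions. -/
def vWordL (C : LCD n) (i : Fin n) (k : ℕ) : FreeGroup (RegL C.m) :=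
  ((List.range k).map fun t =>
    if h : t < C.m i then (FreeGroup.of (C.label i t h)) ^ ((C.sign i t h : ℤ)) else 1).prod

/-- `s_i`: the sum of the signs of the cut-points of component `i` whose label
is a region of component `i`. -/
def sgn (C : LCD n) (i : Fin n) : ℤ :=
  ((List.range (C.m i)).map fun t =>
    if h : t < C.m i then
      (if (C.label i t h).1.1 = i then ((C.sign i t h : ℤˣ) : ℤ) else 0)
    else 0).sum

/-- The `i`-th longitude word `λ_i = x_{(i,0)}^{-s_i} · v_{i,m_i} ∈ F̄`. -/
def lamWord (C : LCD n) (i : Fin n) : FreeGroup (RegL C.m) :=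
  (FreeGroup.of (baseRegL C i)) ^ (-(sgn C i)) * vWordL C i (C.m i)


/-- The `i`-th meridian `μ_i = x_{(i,0)} ∈ G(C)`. -/
def mu (C : LCD n) (i : Fin n) : GrL C := PresentedGroup.of (baseRegL C i)

/-- The image `v̂_{i,k} = x_{ℓ_{i,1}}^{ε_{i,1}} ⋯ x_{ℓ_{i,k}}^{ε_{i,k}} ∈ G(C)`. -/
def vGL (C : LCD n) (i : Fin n) (k : ℕ) : GrL C :=
  ((List.range k).map fun t =>
    if h : t < C.m i then (PresentedGroup.of (C.label i t h) : GrL C) ^ ((C.sign i t h : ℤ))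
    else 1).prod

/-- The `i`-th longitude `λ̂_i = μ_i^{-s_i} · v̂_{i,m_i} ∈ G(C)`. -/
def lamHat (C : LCD n) (i : Fin n) : GrL C :=
  (mu C i) ^ (-(sgn C i)) * vGL C i (C.m i)

end CutDiagrams

namespace CutDiagrams

/-- The Wirtinger-type relation of a cut-point, as an equation in `G(C)`. -/
theorem label_zpow_mul_next {n : ℕ} (C : LCD n) (i : Fin n) (t : ℕ) (h : t < C.m i) :
    (PresentedGroup.of (C.label i t h) : GrL C) ^ (C.sign i t h : ℤ) *
        PresentedGroup.of (nextRegL C i t h) =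
      PresentedGroup.of (prevRegL C i t h) *
        (PresentedGroup.of (C.label i t h) : GrL C) ^ (C.sign i t h : ℤ) := by
  have hrel : PresentedGroup.mk (relsL C) (relWordL C i t h) = 1 :=
    PresentedGroup.one_of_mem ⟨i, t, h, rfl⟩
  simp only [relWordL, map_mul, map_inv, map_zpow, zpow_neg, mul_assoc] at hrel
  exact (inv_mul_eq_iff_eq_mul.mp (inv_mul_eq_one.mp hrel).symm).symm

theorem vGL_succ {n : ℕ} (C : LCD n) (i : Fin n) (t : ℕ) (h : t < C.m i) :
    vGL C i (t + 1) = vGL C i t *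
      (PresentedGroup.of (C.label i t h) : GrL C) ^ (C.sign i t h : ℤ) := by
  simp [vGL, List.range_succ, h]

/-- The word `v̂_{i,k}` conjugates the generator of the `k`-th region of component `i`
(cyclically indexed) to the meridian. -/
theorem vGL_semiconjBy {n : ℕ} (C : LCD n) (i : Fin n) (k : ℕ) (hk : k ≤ C.m i) (r : RegL C.m)
    (hr : r.1 = (i, k % C.m i)) :
    SemiconjBy (vGL C i k) (PresentedGroup.of r) (mu C i) := by
  induction k generalizing r with
  | zero =>
    obtain rfl : r = baseRegL C i := Subtype.ext (by simpa [baseRegL] using hr)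
    exact SemiconjBy.one_left _
  | succ t ih =>
    obtain rfl : r = nextRegL C i t hk := Subtype.ext hr
    rw [vGL_succ C i t hk]
    refine (ih (Nat.le_of_succ_le hk) (prevRegL C i t hk) ?_).mul_left
      (label_zpow_mul_next C i t hk)
    rw [Nat.mod_eq_of_lt hk]
    rfl

end CutDiagrams

open CutDiagrams in
/-- meridian–longitude commutation. The meridian `μ_i` commutes
in `G(C)` with the image `v̂_{i,m_i}` of the full word of the `i`-th component,
and consequently also with the `i`-th longitude `λ̂_i = μ_i^{-s_i}·v̂_{i,m_i}`. -/
theorem stmt10 (n : ℕ) (C : LCD n) (i : Fin n) :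
    Commute (mu C i) (vGL C i (C.m i)) ∧ Commute (mu C i) (lamHat C i) := by
  have hv : Commute (mu C i) (vGL C i (C.m i)) :=
    (vGL_semiconjBy C i (C.m i) le_rfl (baseRegL C i) (by simp [baseRegL]) :
      Commute (vGL C i (C.m i)) (mu C i)).symm
  exact ⟨hv, ((Commute.refl _).zpow_right _).mul_right hv⟩
end

section
/- Independence of the peripheral system from the choice of basepoints: Let C be an n-component link cut-diagram and fix i₀ with m_{i₀} ≥ 1. Let C^σ be the link cut-diagram obtained from C by moving the basepoint of the i₀-th circle across its first cut-point; explicitly, σ is the region reindexing fixing all regions (j,k) with j≠i₀ and sending (i₀,k) to (i₀, (k−1) mod m_{i₀}), the cut-point list of component i₀ is cyclically rotated to ((ε_{i₀,2},σℓ_{i₀,2}),…,(ε_{i₀,m_{i₀}},σℓ_{i₀,m_{i₀}}),(ε_{i₀,1},σℓ_{i₀,1})), the cut-point lists of the other components are unchanged, and σ is applied to every label of every cut-point of C. Then the peripheral systems of C and C^σ are equivalent: there exist a group isomorphism ρ : G(C) → G(C^σ) and elements g_1,…,g_n ∈ G(C^σ) such that ρ(μ_i) = g_i^{−1} μ′_i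 g_i and ρ(λ̂_i) = g_i^{−1} λ̂′_i g_i for all i, where (μ_i, λ̂_i) and (μ′_i, λ̂′_i) denote the meridian–longitude pairs of C and C^σ respectively. -/
/-!
STATEMENT 11. Link cut-diagram framework; see the definitions below.
Cut-points of component `i` are `0`-indexed by `t < m i` (the `t`-th
cut-point is the paper's `(t+1)`-st). In this indexing, `(k-1) mod m` is
`(k + m - 1) % m`, and the rotated list placing the old first cut-point
last assigns to new position `t` the old position `(t+1) % m`.
-/

namespace CutDiagrams

variable {n : ℕ}

/-- The region reindexing `σ` induced by moving the basepoint of the `i₀`-th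
circle across its first cut-point: it fixes all regions of the other
components and sends `(i₀, k)` to `(i₀, (k-1) mod m_{i₀})`. -/
def sigmaReg (C : LCD n) (i₀ : Fin n) (hm : 1 ≤ C.m i₀) : RegL C.m → RegL C.m :=
  fun r =>
    if r.1.1 = i₀ then
      ⟨(i₀, (r.1.2 + C.m i₀ - 1) % C.m i₀),
        lt_of_lt_of_le (Nat.mod_lt _ (lt_of_lt_of_le Nat.zero_lt_one hm)) (le_max_left _ _)⟩
    else r

/-- The link cut-diagram `C^σ` obtained from `C` by moving the basepoint of the
`i₀`-th circle across its first cut-point: the cut-point list of component `i₀`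
is cyclically rotated (the new `t`-th cut-point is the old `((t+1) mod m_{i₀})`-th,
so the old first cut-point becomes last), the other lists are unchanged, and
`σ` is applied to every label of every cut-point. -/
def baseMove (C : LCD n) (i₀ : Fin n) (hm : 1 ≤ C.m i₀) : LCD n where
  m := C.m
  sign := fun j t ht =>
    if j = i₀ then
      C.sign i₀ ((t + 1) % C.m i₀) (Nat.mod_lt _ (lt_of_lt_of_le Nat.zero_lt_one hm))
    else C.sign j t ht
  label := fun j t ht =>
    sigmaReg C i₀ hm
      (if j = i₀ then
        C.label i₀ ((t + 1) % C.m i₀) (Nat.mod_lt _ (lt_of_lt_of_le Nat.zero_lt_one hm))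
      else C.label j t ht)

end CutDiagrams


/-- If a bijection of generators carries the relators of one presentation onto those of another,
it induces an isomorphism of the presented groups. -/
theorem PresentedGroup.exists_mulEquiv_of_image_eq {α β : Type*} (e : α ≃ β)
    {rels : Set (FreeGroup α)} {rels' : Set (FreeGroup β)}
    (h : FreeGroup.freeGroupCongr e '' rels = rels') :
    ∃ ρ : PresentedGroup rels ≃* PresentedGroup rels',
      ∀ r, ρ (PresentedGroup.of r) = PresentedGroup.of (e r) := by
  subst h
  exact ⟨PresentedGroup.equivPresentedGroup rels e, fun _ => rfl⟩

/-- Moving the first factor of a product to the end conjugates it by that factor. -/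
@[to_additive]
theorem List.mul_prod_range_rotate {M : Type*} [Monoid M] (F : ℕ → M) {m : ℕ} (hm : 1 ≤ m) :
    F 0 * ((List.range m).map fun t => F ((t + 1) % m)).prod =
      ((List.range m).map F).prod * F 0 := by
  obtain ⟨k, rfl⟩ : ∃ k, m = k + 1 := ⟨m - 1, by omega⟩
  rw [List.prod_range_succ, List.prod_range_succ', Nat.mod_self, mul_assoc]
  congr 3
  refine List.map_congr_left fun t ht => ?_
  rw [Nat.mod_eq_of_lt (by simpa using ht)]

/-- The relator `p⁻¹ · l^{-ε} · q · l^{ε}` stating that `p` is the conjugate of `q` by `l^ε`. -/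
def conjRelator {α : Type*} (p q l : α) (ε : ℤˣ) : FreeGroup α :=
  (FreeGroup.of p)⁻¹ * FreeGroup.of l ^ (-(ε : ℤ)) * FreeGroup.of q * FreeGroup.of l ^ (ε : ℤ)

theorem freeGroupCongr_conjRelator {α β : Type*} (e : α ≃ β) (p q l : α) (ε : ℤˣ) :
    FreeGroup.freeGroupCongr e (conjRelator p q l ε) = conjRelator (e p) (e q) (e l) ε := by
  simp [conjRelator]

theorem conjRelator_congr {α : Type*} {p p' q q' l l' : α} {ε ε' : ℤˣ} (hp : p = p')
    (hq : q = q') (hl : l = l') (hε : ε = ε') :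
    conjRelator p q l ε = conjRelator p' q' l' ε' := by
  rw [hp, hq, hl, hε]

theorem PresentedGroup.of_eq_conj {α : Type*} {rels : Set (FreeGroup α)} {p q l : α} {ε : ℤˣ}
    (h : conjRelator p q l ε ∈ rels) :
    (PresentedGroup.of q : PresentedGroup rels) =
      PresentedGroup.of l ^ (ε : ℤ) * PresentedGroup.of p *
        (PresentedGroup.of l ^ (ε : ℤ))⁻¹ := by
  have hrel : (PresentedGroup.of p : PresentedGroup rels)⁻¹ * PresentedGroup.of l ^ (-(ε : ℤ)) *
      PresentedGroup.of q * PresentedGroup.of l ^ (ε : ℤ) = 1 := by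
    have := PresentedGroup.one_of_mem h
    simp only [conjRelator, map_mul, map_inv, map_zpow] at this
    exact this
  rw [zpow_neg, mul_assoc, mul_assoc, inv_mul_eq_one] at hrel
  rw [hrel]
  group

namespace CutDiagrams

variable {n : ℕ}

theorem RegL.mk_congr {m : Fin n → ℕ} {i : Fin n} {k k' : ℕ} (hk : k < max (m i) 1)
    (hk' : k' < max (m i) 1) (h : k = k') : (⟨(i, k), hk⟩ : RegL m) = ⟨(i, k'), hk'⟩ := by
  subst h
  rfl

/-- The inverse of the region reindexing `σ`. -/
def sigmaRegInv (C : LCD n) (i₀ : Fin n) (hm : 1 ≤ C.m i₀) : RegL C.m → RegL C.m :=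
  fun r =>
    if r.1.1 = i₀ then
      ⟨(i₀, (r.1.2 + 1) % C.m i₀), lt_of_lt_of_le (Nat.mod_lt _ hm) (le_max_left _ _)⟩
    else r

theorem sigmaReg_mk (C : LCD n) (i₀ : Fin n) (hm : 1 ≤ C.m i₀) (k : ℕ)
    (h : k < max (C.m i₀) 1) :
    sigmaReg C i₀ hm ⟨(i₀, k), h⟩ =
      ⟨(i₀, (k + C.m i₀ - 1) % C.m i₀), lt_max_of_lt_left (Nat.mod_lt _ hm)⟩ :=
  if_pos rfl

theorem sigmaRegInv_mk (C : LCD n) (i₀ : Fin n) (hm : 1 ≤ C.m i₀) (k : ℕ)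
    (h : k < max (C.m i₀) 1) :
    sigmaRegInv C i₀ hm ⟨(i₀, k), h⟩ =
      ⟨(i₀, (k + 1) % C.m i₀), lt_max_of_lt_left (Nat.mod_lt _ hm)⟩ :=
  if_pos rfl

theorem sigmaReg_of_ne (C : LCD n) {i₀ : Fin n} (hm : 1 ≤ C.m i₀) {r : RegL C.m}
    (hr : r.1.1 ≠ i₀) : sigmaReg C i₀ hm r = r :=
  if_neg hr

theorem sigmaRegInv_of_ne (C : LCD n) {i₀ : Fin n} (hm : 1 ≤ C.m i₀) {r : RegL C.m}
    (hr : r.1.1 ≠ i₀) : sigmaRegInv C i₀ hm r = r :=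
  if_neg hr

/-- The region reindexing `σ` as a bijection from the regions of `C` to those of `C^σ`. -/
def sigmaEquiv (C : LCD n) (i₀ : Fin n) (hm : 1 ≤ C.m i₀) :
    RegL C.m ≃ RegL (baseMove C i₀ hm).m where
  toFun := sigmaReg C i₀ hm
  invFun := sigmaRegInv C i₀ hm
  left_inv := by
    rintro ⟨⟨j, k⟩, hk⟩
    by_cases hj : j = i₀
    · subst hj
      have hk' : k < C.m j := lt_of_lt_of_eq hk (max_eq_left hm)
      rw [sigmaReg_mk]
      refine (sigmaRegInv_mk C j hm _ _).trans (RegL.mk_congr _ _ ?_)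
      rw [Nat.mod_add_mod, Nat.sub_add_cancel (by omega), Nat.add_mod_right,
        Nat.mod_eq_of_lt hk']
    · exact (congrArg (sigmaRegInv C i₀ hm) (sigmaReg_of_ne C hm hj)).trans
        (sigmaRegInv_of_ne C hm hj)
  right_inv := by
    rintro ⟨⟨j, k⟩, hk⟩
    by_cases hj : j = i₀
    · subst hj
      have hk' : k < C.m j := lt_of_lt_of_eq hk (max_eq_left hm)
      refine (congrArg (sigmaReg C j hm) (sigmaRegInv_mk C j hm _ _)).trans
        ((sigmaReg_mk C j hm _ _).trans (RegL.mk_congr _ _ ?_))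
      rw [Nat.add_sub_assoc hm, Nat.mod_add_mod,
        show k + 1 + (C.m j - 1) = k + C.m j by omega, Nat.add_mod_right, Nat.mod_eq_of_lt hk']
    · exact (congrArg (sigmaReg C i₀ hm) (sigmaRegInv_of_ne C hm hj)).trans
        (sigmaReg_of_ne C hm hj)

theorem sigmaEquiv_fst (C : LCD n) (i₀ : Fin n) (hm : 1 ≤ C.m i₀) (r : RegL C.m) :
    (sigmaEquiv C i₀ hm r).1.1 = r.1.1 := by
  change (sigmaReg C i₀ hm r).1.1 = r.1.1
  by_cases h : r.1.1 = i₀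
  · obtain ⟨⟨j, k⟩, hk⟩ := r
    obtain rfl : j = i₀ := h
    rw [sigmaReg_mk]
  · rw [sigmaReg_of_ne C hm h]

theorem sigmaEquiv_succ_mod (C : LCD n) (i₀ : Fin n) (hm : 1 ≤ C.m i₀) (t : ℕ)
    (h : (t + 1) % C.m i₀ < max (C.m i₀) 1) (h' : t % C.m i₀ < max (C.m i₀) 1) :
    sigmaEquiv C i₀ hm ⟨(i₀, (t + 1) % C.m i₀), h⟩ = ⟨(i₀, t % C.m i₀), h'⟩ := by
  refine (sigmaReg_mk C i₀ hm _ _).trans (RegL.mk_congr _ _ ?_)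
  rw [Nat.add_sub_assoc hm, Nat.mod_add_mod,
    show t + 1 + (C.m i₀ - 1) = t + C.m i₀ by omega, Nat.add_mod_right]

theorem baseMove_sign_self (C : LCD n) (i₀ : Fin n) (hm : 1 ≤ C.m i₀) (t : ℕ)
    (ht : t < C.m i₀) :
    (baseMove C i₀ hm).sign i₀ t ht = C.sign i₀ ((t + 1) % C.m i₀) (Nat.mod_lt _ hm) :=
  if_pos rfl

theorem baseMove_label_self (C : LCD n) (i₀ : Fin n) (hm : 1 ≤ C.m i₀) (t : ℕ)
    (ht : t < C.m i₀) :
    (baseMove C i₀ hm).label i₀ t ht =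
      sigmaEquiv C i₀ hm (C.label i₀ ((t + 1) % C.m i₀) (Nat.mod_lt _ hm)) :=
  congrArg (sigmaReg C i₀ hm) (if_pos rfl)

theorem baseMove_sign_of_ne (C : LCD n) {i₀ i : Fin n} (hm : 1 ≤ C.m i₀) (hi : i ≠ i₀) (t : ℕ)
    (ht : t < C.m i) : (baseMove C i₀ hm).sign i t ht = C.sign i t ht :=
  if_neg hi

theorem baseMove_label_of_ne (C : LCD n) {i₀ i : Fin n} (hm : 1 ≤ C.m i₀) (hi : i ≠ i₀) (t : ℕ)
    (ht : t < C.m i) :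
    (baseMove C i₀ hm).label i t ht = sigmaEquiv C i₀ hm (C.label i t ht) :=
  congrArg (sigmaReg C i₀ hm) (if_neg hi)

theorem relWordL_eq_conjRelator (C : LCD n) (i : Fin n) (t : ℕ) (h : t < C.m i) :
    relWordL C i t h =
      conjRelator (nextRegL C i t h) (prevRegL C i t h) (C.label i t h) (C.sign i t h) :=
  rfl

theorem freeGroupCongr_relWordL_succ_mod (C : LCD n) (i₀ : Fin n) (hm : 1 ≤ C.m i₀) (t : ℕ)
    (h : t < C.m i₀) :
    FreeGroup.freeGroupCongr (sigmaEquiv C i₀ hm)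
        (relWordL C i₀ ((t + 1) % C.m i₀) (Nat.mod_lt _ hm)) =
      relWordL (baseMove C i₀ hm) i₀ t h := by
  rw [relWordL_eq_conjRelator, freeGroupCongr_conjRelator]
  refine conjRelator_congr ?_ ?_ (baseMove_label_self C i₀ hm t h).symm
    (baseMove_sign_self C i₀ hm t h).symm
  · exact (congrArg _ (RegL.mk_congr _ (lt_max_of_lt_left (Nat.mod_lt _ hm))
      (Nat.mod_add_mod _ _ _))).trans
        (sigmaEquiv_succ_mod C i₀ hm (t + 1) _ (lt_max_of_lt_left (Nat.mod_lt _ hm)))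
  · exact (sigmaEquiv_succ_mod C i₀ hm t _ (lt_max_of_lt_left (Nat.mod_lt _ hm))).trans
      (RegL.mk_congr _ _ (Nat.mod_eq_of_lt h))

theorem freeGroupCongr_relWordL_of_ne (C : LCD n) {i₀ i : Fin n} (hm : 1 ≤ C.m i₀) (hi : i ≠ i₀)
    (t : ℕ) (h : t < C.m i) :
    FreeGroup.freeGroupCongr (sigmaEquiv C i₀ hm) (relWordL C i t h) =
      relWordL (baseMove C i₀ hm) i t h := by
  rw [relWordL_eq_conjRelator, freeGroupCongr_conjRelator]
  exact conjRelator_congr (sigmaReg_of_ne C hm hi) (sigmaReg_of_ne C hm hi)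
    (baseMove_label_of_ne C hm hi t h).symm (baseMove_sign_of_ne C hm hi t h).symm

theorem image_relsL (C : LCD n) (i₀ : Fin n) (hm : 1 ≤ C.m i₀) :
    FreeGroup.freeGroupCongr (sigmaEquiv C i₀ hm) '' relsL C = relsL (baseMove C i₀ hm) := by
  ext w
  constructor
  · rintro ⟨_, ⟨i, t, h, rfl⟩, rfl⟩
    by_cases hi : i = i₀
    · subst hi
      have hlt : (t + (C.m i - 1)) % C.m i < C.m i := Nat.mod_lt _ hm
      refine ⟨i, (t + (C.m i - 1)) % C.m i, hlt, ?_⟩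
      rw [← freeGroupCongr_relWordL_succ_mod C i hm _ hlt]
      congr 2
      rw [Nat.mod_add_mod, show t + (C.m i - 1) + 1 = t + C.m i by omega, Nat.add_mod_right,
        Nat.mod_eq_of_lt h]
    · exact ⟨i, t, h, freeGroupCongr_relWordL_of_ne C hm hi t h⟩
  · rintro ⟨i, t, h, rfl⟩
    by_cases hi : i = i₀
    · subst hi
      exact ⟨_, ⟨i, _, _, rfl⟩, freeGroupCongr_relWordL_succ_mod C i hm t h⟩
    · exact ⟨_, ⟨i, t, h, rfl⟩, freeGroupCongr_relWordL_of_ne C hm hi t h⟩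

theorem sgn_baseMove (C : LCD n) (i₀ : Fin n) (hm : 1 ≤ C.m i₀) (i : Fin n) :
    sgn (baseMove C i₀ hm) i = sgn C i := by
  by_cases hi : i = i₀
  · subst hi
    have key := List.add_sum_range_rotate (fun t => if h : t < C.m i then
      (if (C.label i t h).1.1 = i then ((C.sign i t h : ℤˣ) : ℤ) else 0) else 0) hm
    rw [add_comm] at key
    refine Eq.trans ?_ (add_right_cancel key)
    refine congrArg List.sum (List.map_congr_left fun t ht => ?_)
    have ht' : t < C.m i := List.mem_range.mp ht
    rw [dif_pos (show t < (baseMove C i hm).m i from ht'), dif_pos (Nat.mod_lt _ hm),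
      baseMove_sign_self, baseMove_label_self, sigmaEquiv_fst]
  · refine congrArg List.sum (List.map_congr_left fun t ht => ?_)
    have ht' : t < C.m i := List.mem_range.mp ht
    rw [dif_pos (show t < (baseMove C i₀ hm).m i from ht'), dif_pos ht',
      baseMove_sign_of_ne C hm hi, baseMove_label_of_ne C hm hi, sigmaEquiv_fst]

section Peripheral

variable (C : LCD n) {i₀ : Fin n} (hm : 1 ≤ C.m i₀) (ρ : GrL C ≃* GrL (baseMove C i₀ hm))
  (hρ : ∀ r, ρ (PresentedGroup.of r) = PresentedGroup.of (sigmaEquiv C i₀ hm r))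

include hρ

theorem map_mu_of_ne {i : Fin n} (hi : i ≠ i₀) : ρ (mu C i) = mu (baseMove C i₀ hm) i :=
  (hρ _).trans (congrArg PresentedGroup.of (sigmaReg_of_ne C hm hi))

theorem map_vGL_of_ne {i : Fin n} (hi : i ≠ i₀) :
    ρ (vGL C i (C.m i)) = vGL (baseMove C i₀ hm) i (C.m i) := by
  rw [vGL, map_list_prod, List.map_map]
  refine congrArg List.prod (List.map_congr_left fun t ht => ?_)
  have ht' : t < C.m i := List.mem_range.mp ht
  rw [Function.comp_apply, dif_pos ht', dif_pos (show t < (baseMove C i₀ hm).m i from ht'),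
    baseMove_sign_of_ne C hm hi, baseMove_label_of_ne C hm hi, map_zpow, hρ]

theorem mul_vGL_baseMove :
    ρ (PresentedGroup.of (C.label i₀ 0 hm) ^ (C.sign i₀ 0 hm : ℤ)) *
        vGL (baseMove C i₀ hm) i₀ (C.m i₀) =
      ρ (vGL C i₀ (C.m i₀)) *
        ρ (PresentedGroup.of (C.label i₀ 0 hm) ^ (C.sign i₀ 0 hm : ℤ)) := by
  have key := List.mul_prod_range_rotate (fun t => ρ (if h : t < C.m i₀ then
    (PresentedGroup.of (C.label i₀ t h) : GrL C) ^ ((C.sign i₀ t h : ℤ)) else 1)) hm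
  rw [dif_pos (show 0 < C.m i₀ from hm)] at key
  rw [vGL, vGL, map_list_prod, List.map_map]
  refine Eq.trans (congrArg _ (congrArg List.prod (List.map_congr_left fun t ht => ?_))) key
  have ht' : t < C.m i₀ := List.mem_range.mp ht
  rw [dif_pos (show t < (baseMove C i₀ hm).m i₀ from ht'), dif_pos (Nat.mod_lt _ hm),
    baseMove_sign_self, baseMove_label_self, map_zpow, hρ]

/-- The relation at the first cut-point of component `i₀`. -/
theorem map_mu_self :
    ρ (mu C i₀) = ρ (PresentedGroup.of (C.label i₀ 0 hm) ^ (C.sign i₀ 0 hm : ℤ)) *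
      mu (baseMove C i₀ hm) i₀ *
      (ρ (PresentedGroup.of (C.label i₀ 0 hm) ^ (C.sign i₀ 0 hm : ℤ)))⁻¹ := by
  have hnext : ρ (PresentedGroup.of (nextRegL C i₀ 0 hm)) = mu (baseMove C i₀ hm) i₀ :=
    (hρ _).trans (congrArg PresentedGroup.of
      ((sigmaEquiv_succ_mod C i₀ hm 0 _ (lt_max_of_lt_left (Nat.mod_lt _ hm))).trans
        (RegL.mk_congr _ _ (Nat.zero_mod _))))
  rw [← hnext, ← map_inv, ← map_mul, ← map_mul]
  exact congrArg ρ (PresentedGroup.of_eq_conj (rels := relsL C) ⟨i₀, 0, hm, rfl⟩)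

end Peripheral

end CutDiagrams

open CutDiagrams in
/-- independence of the peripheral system from the choice of
basepoints. The peripheral systems of `C` and `C^σ` are equivalent: there are
a group isomorphism `ρ : G(C) → G(C^σ)` and elements `g_i ∈ G(C^σ)` with
`ρ(μ_i) = g_i⁻¹ μ'_i g_i` and `ρ(λ̂_i) = g_i⁻¹ λ̂'_i g_i` for all `i`. -/
theorem stmt11 (n : ℕ) (C : LCD n) (i₀ : Fin n) (hm : 1 ≤ C.m i₀) :
    ∃ ρ : GrL C ≃* GrL (baseMove C i₀ hm), ∃ g : Fin n → GrL (baseMove C i₀ hm),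
      ∀ i : Fin n,
        ρ (mu C i) = (g i)⁻¹ * mu (baseMove C i₀ hm) i * g i ∧
        ρ (lamHat C i) = (g i)⁻¹ * lamHat (baseMove C i₀ hm) i * g i := by
  obtain ⟨ρ, hρ⟩ : ∃ ρ : GrL C ≃* GrL (baseMove C i₀ hm),
      ∀ r, ρ (PresentedGroup.of r) = PresentedGroup.of (sigmaEquiv C i₀ hm r) :=
    PresentedGroup.exists_mulEquiv_of_image_eq _ (image_relsL C i₀ hm)
  refine ⟨ρ, fun i => if i = i₀ then
    (ρ (PresentedGroup.of (C.label i₀ 0 hm) ^ (C.sign i₀ 0 hm : ℤ)))⁻¹ else 1, fun i => ?_⟩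
  have hlam : lamHat (baseMove C i₀ hm) i =
      mu (baseMove C i₀ hm) i ^ (-sgn C i) * vGL (baseMove C i₀ hm) i (C.m i) := by
    rw [lamHat, sgn_baseMove]
    rfl
  beta_reduce
  rw [hlam, lamHat, map_mul, map_zpow ρ (mu C i)]
  by_cases hi : i = i₀
  · subst hi
    have hv := mul_vGL_baseMove C hm ρ hρ
    rw [map_mu_self C hm ρ hρ, conj_zpow, if_pos rfl, inv_inv]
    refine ⟨rfl, ?_⟩
    rw [eq_mul_inv_of_mul_eq hv.symm]
    simp only [mul_assoc, inv_mul_cancel_left]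
  · rw [map_mu_of_ne C hm ρ hρ hi, map_vGL_of_ne C hm ρ hρ hi, if_neg hi]
    simp
end

section
/- Presentation of the reduced group (string-link case): Let C be an n-component string-link cut-diagram. Define the reduced group RG(C) := G(C)/K, where K is the normal closure in G(C) of the set {[x_r, g^{−1} x_r g] : r ∈ R(C), g ∈ G(C)}, and define the reduced free group RF_n := F/K′, where F is the free group on x_1,…,x_n and K′ is the normal closure in F of {[x_i, w^{−1} x_i w] : 1 ≤ i ≤ n, w ∈ F}. Then the assignment x_i ↦ x_{(i,0)} induces a group isomorphism RF_n ≅ RG(C). -/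
/-!
STATEMENT 12. String-link cut-diagram framework; see the definitions below.
`[a,b]` denotes `a⁻¹b⁻¹ab`, written out explicitly.
-/

namespace CutDiagrams

variable {n : ℕ}

/-- The normal subgroup `K ⊴ G(C)` generated by all `[x_r, g⁻¹ x_r g]`
(with `[a,b] = a⁻¹b⁻¹ab`), whose quotient is the reduced group `RG(C)`. -/
def Kred (C : SLCD n) : Subgroup (G C) :=
  Subgroup.normalClosure
    {w | ∃ (r : Reg C.m) (g : G C),
      w = (PresentedGroup.of r : G C)⁻¹ * (g⁻¹ * PresentedGroup.of r * g)⁻¹ *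
        PresentedGroup.of r * (g⁻¹ * PresentedGroup.of r * g)}

/-- The normal subgroup `K' ⊴ F` generated by all `[x_i, w⁻¹ x_i w]`, whose
quotient is the reduced free group `RF_n`. -/
def KF (n : ℕ) : Subgroup (FreeGroup (Fin n)) :=
  Subgroup.normalClosure
    {w | ∃ (i : Fin n) (u : FreeGroup (Fin n)),
      w = (FreeGroup.of i)⁻¹ * (u⁻¹ * FreeGroup.of i * u)⁻¹ *
        FreeGroup.of i * (u⁻¹ * FreeGroup.of i * u)}

instance (C : SLCD n) : (Kred C).Normal := Subgroup.normalClosure_normal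

instance : (KF n).Normal := Subgroup.normalClosure_normal

end CutDiagrams

namespace CutDiagrams

section Nilpotency

open Subgroup
open scoped commutatorElement

/-- If `s` commutes with all its conjugates, then it commutes with its normal closure. -/
theorem commute_of_mem_normalClosure {N : Type*} [Group N] {s c : N}
    (hs : ∀ g : N, Commute s (g⁻¹ * s * g)) (hc : c ∈ normalClosure {s}) : Commute s c := by
  have hle : normalClosure {s} ≤ centralizer {s} := by
    refine (closure_le _).2 fun x hx => ?_
    obtain ⟨a, rfl, hax⟩ := Group.mem_conjugatesOfSet_iff.1 hx
    obtain ⟨g, rfl⟩ := isConj_iff.1 hax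
    have h := hs g⁻¹
    rw [inv_inv] at h
    exact mem_centralizer_singleton_iff.2 h.eq.symm
  exact (mem_centralizer_singleton_iff.1 (hle hc)).symm

/-- A group generated by `k` elements, each commuting with all its conjugates, is nilpotent of
class at most `k`. -/
theorem lowerCentralSeries_eq_bot_of_commute_conj (k : ℕ) :
    ∀ {N : Type*} [Group N] (S : Finset N), S.card ≤ k → closure (S : Set N) = ⊤ →
      (∀ s ∈ S, ∀ g : N, Commute s (g⁻¹ * s * g)) →
      (⊤ : Subgroup N).lowerCentralSeries k = ⊥ := by
  classical
  induction k with
  | zero =>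
    intro N _ S hS hgen _
    have : S = ∅ := by simpa using hS
    subst this
    simpa using hgen.symm
  | succ k ih =>
    intro N _ S hS hgen hcomm
    have hcentral : ∀ c ∈ (⊤ : Subgroup N).lowerCentralSeries k, ∀ s ∈ S, Commute s c := by
      intro c hc s hs
      refine commute_of_mem_normalClosure (hcomm s hs) ?_
      let f := QuotientGroup.mk' (normalClosure {s})
      have hf : Function.Surjective f := QuotientGroup.mk'_surjective _
      have hfs : f s = 1 := (QuotientGroup.eq_one_iff s).2 (subset_normalClosure rfl)
      have hbot := ih ((S.erase s).image f)
        (Finset.card_image_le.trans (by rw [Finset.card_erase_of_mem hs]; omega)) ?_ ?_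
      · have hfc := mem_map_of_mem f hc
        rw [map_lowerCentralSeries, map_top_of_surjective f hf, hbot, mem_bot] at hfc
        exact (QuotientGroup.eq_one_iff c).1 hfc
      · rw [eq_top_iff, ← map_top_of_surjective f hf, ← hgen, MonoidHom.map_closure, closure_le]
        rintro _ ⟨a, ha, rfl⟩
        by_cases has : a = s
        · rw [has, hfs]
          exact one_mem _
        · exact subset_closure
            (Finset.mem_coe.2 (Finset.mem_image_of_mem f (Finset.mem_erase.2 ⟨has, ha⟩)))
      · intro a ha g
        obtain ⟨b, hb, rfl⟩ := Finset.mem_image.1 ha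
        obtain ⟨g, rfl⟩ := hf g
        simpa only [map_mul, map_inv] using (hcomm b (Finset.mem_of_mem_erase hb) g).map f
    refine Subgroup.lowerCentralSeries_succ_eq_bot _ fun c hc => mem_center_iff.2 fun g => ?_
    have hle : closure (S : Set N) ≤ centralizer {c} :=
      (closure_le _).2 fun s hs => mem_centralizer_singleton_iff.2 (hcentral c hc s hs).eq
    exact mem_centralizer_singleton_iff.1 (hle (hgen ▸ mem_top g))

/-- A group generated by a finite family of elements, each commuting with all its conjugates, is
nilpotent. -/
theorem exists_lowerCentralSeries_eq_bot {N ι : Type*} [Group N] [Finite ι] (f : ι → N)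
    (hgen : closure (Set.range f) = ⊤) (hcomm : ∀ i, ∀ g : N, Commute (f i) (g⁻¹ * f i * g)) :
    ∃ k, (⊤ : Subgroup N).lowerCentralSeries k = ⊥ := by
  have hfin := Set.finite_range f
  refine ⟨_, lowerCentralSeries_eq_bot_of_commute_conj _ hfin.toFinset le_rfl
    (by rwa [hfin.coe_toFinset]) fun s hs => ?_⟩
  obtain ⟨i, rfl⟩ := hfin.mem_toFinset.1 hs
  exact hcomm i

/-- Conjugating by elements congruent modulo the `k`-th term of the lower central series preserves
congruence modulo the next term. -/
theorem conj_congr_lowerCentralSeries {N : Type*} [Group N] {k : ℕ} {u v p q : N}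
    (huv : u⁻¹ * v ∈ (⊤ : Subgroup N).lowerCentralSeries k)
    (hpq : p⁻¹ * q ∈ (⊤ : Subgroup N).lowerCentralSeries (k + 1)) :
    (u⁻¹ * p * u)⁻¹ * (v⁻¹ * q * v) ∈ (⊤ : Subgroup N).lowerCentralSeries (k + 1) := by
  have hcomm : ⁅(u⁻¹ * v)⁻¹, (u⁻¹ * p * u)⁻¹⁆ ∈ (⊤ : Subgroup N).lowerCentralSeries (k + 1) :=
    commutator_mem_commutator (inv_mem huv) (mem_top _)
  have hconj := (lowerCentralSeries_normal (⊤ : Subgroup N) (k + 1)).conj_mem _ hpq v⁻¹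
  convert mul_mem (inv_mem hcomm) hconj using 1
  simp only [commutatorElement_def]
  group

end Nilpotency

variable {n : ℕ} {N : Type*} [Group N]

instance (m : Fin n → ℕ) : Finite (Reg m) := by
  refine Finite.of_surjective
    (fun r : Σ i, Fin (m i + 1) => (⟨(r.1, r.2), Nat.le_of_lt_succ r.2.2⟩ : Reg m)) ?_
  rintro ⟨⟨i, t⟩, h⟩
  exact ⟨⟨i, t, Nat.lt_succ_of_le h⟩, rfl⟩

/-- The meridian of the `t`-th region of component `i` obtained from the initial meridian `x i` by
conjugating successively with the meridians `y` of the cut-point labels. -/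
def transport (C : SLCD n) (x : Fin n → N) (y : Reg C.m → N) (i : Fin n) :
    (t : ℕ) → t ≤ C.m i → N
  | 0, _ => x i
  | t + 1, h => (y (C.label i t h) ^ (C.sign i t h : ℤ))⁻¹ *
      transport C x y i t (Nat.le_of_succ_le h) * y (C.label i t h) ^ (C.sign i t h : ℤ)

/-- The assignment of meridians `transport C x y`, as a function of the region. -/
def transportReg (C : SLCD n) (x : Fin n → N) (y : Reg C.m → N) (r : Reg C.m) : N :=
  transport C x y r.1.1 r.1.2 r.2

theorem transport_eq_conj (C : SLCD n) (x : Fin n → N) (y : Reg C.m → N) (i : Fin n) (t : ℕ)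
    (h : t ≤ C.m i) : ∃ g, transport C x y i t h = g⁻¹ * x i * g := by
  induction t with
  | zero => exact ⟨1, by simp [transport]⟩
  | succ t ih =>
    obtain ⟨g, hg⟩ := ih (Nat.le_of_succ_le h)
    exact ⟨g * y (C.label i t h) ^ (C.sign i t h : ℤ), by rw [transport, hg]; group⟩

theorem transport_congr (C : SLCD n) (x : Fin n → N) {y z : Reg C.m → N} {k : ℕ}
    (hyz : ∀ r, (y r)⁻¹ * z r ∈ (⊤ : Subgroup N).lowerCentralSeries k) (i : Fin n) (t : ℕ)
    (h : t ≤ C.m i) :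
    (transport C x y i t h)⁻¹ * transport C x z i t h ∈
      (⊤ : Subgroup N).lowerCentralSeries (k + 1) := by
  induction t with
  | zero =>
    simp only [transport, inv_mul_cancel]
    exact one_mem _
  | succ t ih =>
    refine conj_congr_lowerCentralSeries ?_ (ih _)
    have hl := QuotientGroup.eq.2 (hyz (C.label i t h))
    exact QuotientGroup.eq.1 (by rw [QuotientGroup.mk_zpow, hl, QuotientGroup.mk_zpow])

theorem eq_of_transportReg_eq_self (C : SLCD n) (x : Fin n → N) {y z : Reg C.m → N} {c : ℕ}
    (hN : (⊤ : Subgroup N).lowerCentralSeries c = ⊥) (hy : transportReg C x y = y)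
    (hz : transportReg C x z = z) : y = z := by
  have key : ∀ k r, (y r)⁻¹ * z r ∈ (⊤ : Subgroup N).lowerCentralSeries k := by
    intro k
    induction k with
    | zero => exact fun r => Subgroup.mem_top _
    | succ k ih =>
      intro r
      rw [← hy, ← hz]
      exact transport_congr C x ih _ _ _
  funext r
  have h := key c r
  rwa [hN, Subgroup.mem_bot, inv_mul_eq_one] at h

theorem exists_transportReg_eq_self (C : SLCD n) (x : Fin n → N) {c : ℕ}
    (hN : (⊤ : Subgroup N).lowerCentralSeries c = ⊥) :
    ∃ y : Reg C.m → N, transportReg C x y = y := by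
  have key : ∀ k r, ((transportReg C x)^[k] 1 r)⁻¹ * (transportReg C x)^[k + 1] 1 r ∈
      (⊤ : Subgroup N).lowerCentralSeries k := by
    intro k
    induction k with
    | zero => exact fun r => Subgroup.mem_top _
    | succ k ih =>
      intro r
      rw [Function.iterate_succ_apply' _ (k + 1), Function.iterate_succ_apply' _ k]
      rw [Function.iterate_succ_apply' _ k] at ih
      exact transport_congr C x ih _ _ _
  refine ⟨(transportReg C x)^[c] 1, funext fun r => ?_⟩
  have h := key c r
  rw [hN, Subgroup.mem_bot, inv_mul_eq_one, Function.iterate_succ_apply'] at h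
  exact h.symm

theorem lift_relWord_eq_one_iff (C : SLCD n) (y : Reg C.m → N) (i : Fin n) (t : ℕ)
    (h : t < C.m i) :
    FreeGroup.lift y (relWord C i t h) = 1 ↔
      y (nextReg C i t h) = (y (C.label i t h) ^ (C.sign i t h : ℤ))⁻¹ * y (prevReg C i t h) *
        y (C.label i t h) ^ (C.sign i t h : ℤ) := by
  simp only [relWord, map_mul, map_inv, map_zpow, FreeGroup.lift_apply_of, zpow_neg, mul_assoc,
    inv_mul_eq_one]

/-- Meridian assignments satisfying the Wirtinger relations are the fixed points of
`transportReg`. -/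
theorem transportReg_eq_self (C : SLCD n) (x : Fin n → N) {y : Reg C.m → N}
    (hx : ∀ i, y ⟨(i, 0), Nat.zero_le _⟩ = x i)
    (hy : ∀ w ∈ rels C, FreeGroup.lift y w = 1) : transportReg C x y = y := by
  funext ⟨⟨i, t⟩, h⟩
  induction t with
  | zero => exact (hx i).symm
  | succ t ih =>
    refine Eq.trans ?_ ((lift_relWord_eq_one_iff C y i t h).1 (hy _ ⟨i, t, h, rfl⟩)).symm
    exact congrArg (fun a => _⁻¹ * a * _) (ih (Nat.le_of_succ_le h))

theorem lift_eq_one_of_transportReg_eq_self (C : SLCD n) (x : Fin n → N) {y : Reg C.m → N}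
    (hy : transportReg C x y = y) : ∀ w ∈ rels C, FreeGroup.lift y w = 1 := by
  rintro _ ⟨i, t, h, rfl⟩
  rw [lift_relWord_eq_one_iff]
  have hprev : transport C x y i t h.le = y (prevReg C i t h) := congrFun hy (prevReg C i t h)
  rw [← hprev]
  exact (congrFun hy (nextReg C i t h)).symm

theorem commute_iff_commutator_eq_one {a b : N} : a⁻¹ * b⁻¹ * a * b = 1 ↔ Commute a b := by
  rw [← mul_inv_rev, mul_assoc, inv_mul_eq_one, commute_iff_eq, eq_comm]

theorem commute_conj_mk_of (i : Fin n) (g : FreeGroup (Fin n) ⧸ KF n) :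
    Commute (QuotientGroup.mk (FreeGroup.of i)) (g⁻¹ * QuotientGroup.mk (FreeGroup.of i) * g) := by
  obtain ⟨u, rfl⟩ := QuotientGroup.mk_surjective g
  exact commute_iff_commutator_eq_one.1
    ((QuotientGroup.eq_one_iff _).2 (Subgroup.subset_normalClosure ⟨i, u, rfl⟩))

theorem commute_conj_mk_presentedGroup_of (C : SLCD n) (r : Reg C.m) (g : G C ⧸ Kred C) :
    Commute (QuotientGroup.mk (PresentedGroup.of r))
      (g⁻¹ * QuotientGroup.mk (PresentedGroup.of r) * g) := by
  obtain ⟨u, rfl⟩ := QuotientGroup.mk_surjective g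
  exact commute_iff_commutator_eq_one.1
    ((QuotientGroup.eq_one_iff _).2 (Subgroup.subset_normalClosure ⟨r, u, rfl⟩))

theorem exists_lowerCentralSeries_reducedFreeGroup_eq_bot (n : ℕ) :
    ∃ k, (⊤ : Subgroup (FreeGroup (Fin n) ⧸ KF n)).lowerCentralSeries k = ⊥ := by
  refine exists_lowerCentralSeries_eq_bot
    (fun i => QuotientGroup.mk' (KF n) (FreeGroup.of i)) ?_ commute_conj_mk_of
  rw [Set.range_comp' (QuotientGroup.mk' (KF n)), ← MonoidHom.map_closure,
    FreeGroup.closure_range_of,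
    Subgroup.map_top_of_surjective _ (QuotientGroup.mk'_surjective _)]

theorem exists_lowerCentralSeries_reducedGroup_eq_bot (C : SLCD n) :
    ∃ k, (⊤ : Subgroup (G C ⧸ Kred C)).lowerCentralSeries k = ⊥ := by
  refine exists_lowerCentralSeries_eq_bot
    (fun r : Reg C.m => QuotientGroup.mk' (Kred C) (PresentedGroup.of r)) ?_
    (commute_conj_mk_presentedGroup_of C)
  rw [Set.range_comp' (QuotientGroup.mk' (Kred C)), ← MonoidHom.map_closure,
    PresentedGroup.closure_range_of,
    Subgroup.map_top_of_surjective _ (QuotientGroup.mk'_surjective _)]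

theorem KF_le_comap_phi (C : SLCD n) : KF n ≤ (Kred C).comap (phi C) := by
  refine Subgroup.normalClosure_le_normal ?_
  rintro _ ⟨i, u, rfl⟩
  refine Subgroup.subset_normalClosure ⟨⟨(i, 0), Nat.zero_le _⟩, phi C u, ?_⟩
  simp [phi]

end CutDiagrams

open CutDiagrams in
/-- the assignment `x_i ↦ x_{(i,0)}` induces a group isomorphism
`RF_n ≅ RG(C)` between the reduced free group and the reduced group of a
string-link cut-diagram. -/
theorem stmt12 (n : ℕ) (C : SLCD n) :
    ∃ e : (FreeGroup (Fin n) ⧸ KF n) ≃* (G C ⧸ Kred C),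
      ∀ w : FreeGroup (Fin n),
        e (QuotientGroup.mk w) = QuotientGroup.mk (phi C w) := by
  obtain ⟨c, hc⟩ := exists_lowerCentralSeries_reducedFreeGroup_eq_bot n
  obtain ⟨d, hd⟩ := exists_lowerCentralSeries_reducedGroup_eq_bot C
  let x : Fin n → FreeGroup (Fin n) ⧸ KF n := fun i => QuotientGroup.mk (FreeGroup.of i)
  obtain ⟨y, hy⟩ := exists_transportReg_eq_self C x hc
  have hy0 : ∀ i, y ⟨(i, 0), Nat.zero_le _⟩ = x i := fun i => by rw [← hy]; rfl
  have hrel := lift_eq_one_of_transportReg_eq_self C x hy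
  let ψ₀ : G C →* FreeGroup (Fin n) ⧸ KF n := PresentedGroup.toGroup hrel
  have hψ₀ : ∀ r, ψ₀ (PresentedGroup.of r) = y r := fun r => PresentedGroup.toGroup.of hrel
  have hker : Kred C ≤ ψ₀.ker := by
    refine Subgroup.normalClosure_le_normal ?_
    rintro _ ⟨r, g, rfl⟩
    obtain ⟨u, hu⟩ := transport_eq_conj C x y r.1.1 r.1.2 r.2
    have hyr : y r = u⁻¹ * x r.1.1 * u := (congrFun hy r).symm.trans hu
    rw [SetLike.mem_coe, MonoidHom.mem_ker]
    simp only [map_mul, map_inv, hψ₀]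
    rw [commute_iff_commutator_eq_one, hyr]
    have h := commute_conj_mk_of r.1.1 (u * ψ₀ g * u⁻¹)
    have h' := h.map (MulAut.conj u⁻¹)
    simp only [MulAut.conj_apply] at h'
    convert h' using 1 <;> simp only [x] <;> group
  let φ : FreeGroup (Fin n) ⧸ KF n →* G C ⧸ Kred C :=
    QuotientGroup.map _ _ (phi C) (KF_le_comap_phi C)
  let ψ : G C ⧸ Kred C →* FreeGroup (Fin n) ⧸ KF n := QuotientGroup.lift _ ψ₀ hker
  have hφx : ∀ i, φ (x i) = QuotientGroup.mk (PresentedGroup.of ⟨(i, 0), Nat.zero_le _⟩) := by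
    intro i
    simp [φ, x, phi]
  have hψφ : ψ.comp φ = MonoidHom.id _ := by
    refine QuotientGroup.monoidHom_ext _ (FreeGroup.ext_hom _ _ fun i => ?_)
    change ψ (φ (x i)) = x i
    rw [hφx]
    exact (hψ₀ _).trans (hy0 i)
  have hφψ : φ.comp ψ = MonoidHom.id _ := by
    refine QuotientGroup.monoidHom_ext _ (PresentedGroup.ext fun r => ?_)
    change φ (ψ₀ (PresentedGroup.of r)) = QuotientGroup.mk' (Kred C) (PresentedGroup.of r)
    rw [hψ₀]
    refine congrFun (eq_of_transportReg_eq_self C (fun i => φ (x i)) hd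
      (y := fun r => φ (y r)) (z := fun r => QuotientGroup.mk' (Kred C) (PresentedGroup.of r))
      (transportReg_eq_self C _ (fun i => by rw [hy0]) fun w hw => ?_)
      (transportReg_eq_self C _ (fun i => (hφx i).symm) fun w hw => ?_)) r
    · have hlift : FreeGroup.lift (fun r => φ (y r)) = φ.comp (FreeGroup.lift y) :=
        FreeGroup.ext_hom _ _ fun r => by simp
      rw [hlift, MonoidHom.comp_apply, hrel w hw, map_one]
    · have hlift : FreeGroup.lift
          (fun r => QuotientGroup.mk' (Kred C) (PresentedGroup.of r)) =
          (QuotientGroup.mk' (Kred C)).comp (PresentedGroup.mk (rels C)) :=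
        FreeGroup.ext_hom _ _ fun r => by rw [FreeGroup.lift_apply_of]; rfl
      rw [hlift, MonoidHom.comp_apply, PresentedGroup.one_of_mem hw, map_one]
  exact ⟨MonoidHom.toMulEquiv φ ψ hψφ hφψ, fun w => rfl⟩
end
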